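/- (Completeness of the logic 𝒬Ł.) For every formula φ of 𝒬Ł the following are equivalent: (1) φ is provable in 𝒬Ł; (2) e(φ) = 1 for every DMV-algebra A and every evaluation e into A; (3) e(φ) = 1 for every evaluation e into the standard DMV-algebra [0,1]_ℚ; (4) the equivalence class [φ] equals 1 in the Lindenbaum–Tarski algebra of 𝒬Ł. -/

import Mathlib

/-- An MV-algebra: an abelian monoid `(A, ⊕, 0)` with an involution `*` satisfying
the Łukasiewicz axioms. -/
class MVAlgebra (A : Type) where
  oplus : A → A → A
  star : A → A
  zero : A
  oplus_assoc : ∀ x y z : A, oplus (oplus x y) z = oplus x (oplus y z)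
  oplus_comm : ∀ x y : A, oplus x y = oplus y x
  oplus_zero : ∀ x : A, oplus x zero = x
  star_star : ∀ x : A, star (star x) = x
  lukasiewicz : ∀ x y : A,
    oplus (star (oplus (star x) y)) y = oplus (star (oplus (star y) x)) x
  oplus_star_zero : ∀ x : A, oplus (star zero) x = star zero

namespace MVAlgebra

variable {A : Type} [MVAlgebra A]

/-- The top element `1 = 0*`. -/
def one : A := star zero

/-- The MV-product `x ⊙ y = (x* ⊕ y*)*`. -/
def odot (x y : A) : A := star (oplus (star x) (star y))

/-- `n`-fold ⊕-sum of an element. -/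
def nmul : ℕ → A → A
  | 0, _ => zero
  | n + 1, x => oplus (nmul n x) x

/-- The lattice join `x ∨ y = (x ⊙ y*) ⊕ y`. -/
def sup (x y : A) : A := oplus (odot x (star y)) y

/-- The lattice meet `x ∧ y = (x ⊕ y*) ⊙ y`. -/
def inf (x y : A) : A := odot (oplus x (star y)) y

/-- The MV-order: `x ≤ y` iff `x ⊙ y* = 0`. -/
def le (x y : A) : Prop := odot x (star y) = zero

end MVAlgebra

/-- The rational unit interval `[0,1] ∩ ℚ`. -/
def QI : Type := {q : ℚ // 0 ≤ q ∧ q ≤ 1}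

namespace QI

/-- Truncated addition on `[0,1] ∩ ℚ`. -/
def oplus (r s : QI) : QI :=
  ⟨min (r.1 + s.1) 1, le_min (add_nonneg r.2.1 s.2.1) zero_le_one, min_le_right _ _⟩

/-- Negation `r* = 1 - r` on `[0,1] ∩ ℚ`. -/
def star (r : QI) : QI :=
  ⟨1 - r.1, by constructor <;> [linarith [r.2.2]; linarith [r.2.1]]⟩

def zero : QI := ⟨0, le_refl 0, zero_le_one⟩

def one : QI := ⟨1, zero_le_one, le_refl 1⟩

/-- Ordinary multiplication of rationals, restricted to `[0,1] ∩ ℚ`. -/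
def mul (r s : QI) : QI :=
  ⟨r.1 * s.1, mul_nonneg r.2.1 s.2.1, by nlinarith [r.2.1, r.2.2, s.2.1, s.2.2]⟩

/-- The MV-product `r ⊙ s = (r* ⊕ s*)*` on `[0,1] ∩ ℚ`. -/
def odot (r s : QI) : QI := star (oplus (star r) (star s))

/-- Division by a natural number in `[0,1] ∩ ℚ`. -/
def div (r : QI) (n : ℕ) : QI :=
  ⟨r.1 / n, div_nonneg r.2.1 (Nat.cast_nonneg n), by
    rcases Nat.eq_zero_or_pos n with h | h
    · simp [h]
    · exact le_trans (div_le_self r.2.1 (by exact_mod_cast h)) r.2.2⟩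

/-- `1/n` as an element of `[0,1] ∩ ℚ` (with `1/0 = 0`). -/
def oneOver (n : ℕ) : QI := div one n

/-- Join (maximum) in `[0,1] ∩ ℚ`. -/
def sup (r s : QI) : QI :=
  ⟨max r.1 s.1, le_max_of_le_left r.2.1, max_le r.2.2 s.2.2⟩

/-- Meet (minimum) in `[0,1] ∩ ℚ`. -/
def inf (r s : QI) : QI :=
  ⟨min r.1 s.1, le_min r.2.1 s.2.1, min_le_of_left_le r.2.2⟩

end QI

/-- A DMV-algebra, presented as an MV-algebra with a scalar multiplication by
rationals in `[0,1] ∩ ℚ` satisfying (DMV1')–(DMV4'). -/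
class DMVAlgebra (A : Type) extends MVAlgebra A where
  smul : QI → A → A
  smul_odot : ∀ (r : QI) (x y : A),
    smul r (MVAlgebra.odot x (MVAlgebra.star y)) =
      MVAlgebra.odot (smul r x) (MVAlgebra.star (smul r y))
  odot_smul : ∀ (r q : QI) (x : A),
    smul (QI.odot r (QI.star q)) x =
      MVAlgebra.odot (smul r x) (MVAlgebra.star (smul q x))
  smul_smul : ∀ (r q : QI) (x : A), smul r (smul q x) = smul (QI.mul r q) x
  one_smul : ∀ x : A, smul QI.one x = x

/-- Formulas of the logic `𝒬Ł`: propositional variables, negation, implication, and a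
unary connective `∇_r` for each `r ∈ [0,1] ∩ ℚ`. -/
inductive QForm : Type
  | var : ℕ → QForm
  | neg : QForm → QForm
  | imp : QForm → QForm → QForm
  | nabla : QI → QForm → QForm

namespace QForm

/-- Łukasiewicz disjunction `φ ∨ ψ := (φ → ψ) → ψ`. -/
def lor (φ ψ : QForm) : QForm := imp (imp φ ψ) ψ

/-- Biconditional `φ ↔ ψ := (φ → ψ) ⊙ (ψ → φ) = ¬((φ → ψ) → ¬(ψ → φ))`. -/
def liff (φ ψ : QForm) : QForm := neg (imp (imp φ ψ) (neg (imp ψ φ)))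

/-- Provability in `𝒬Ł`: axioms (L1)–(L4) of Łukasiewicz logic, the axioms
(Q1)–(Q4) for the connectives `∇_r`, and Modus Ponens. -/
inductive Prov : QForm → Prop
  | L1 (φ ψ : QForm) : Prov (imp φ (imp ψ φ))
  | L2 (φ ψ χ : QForm) : Prov (imp (imp φ ψ) (imp (imp ψ χ) (imp φ χ)))
  | L3 (φ ψ : QForm) : Prov (imp (lor φ ψ) (lor ψ φ))
  | L4 (φ ψ : QForm) : Prov (imp (imp (neg ψ) (neg φ)) (imp φ ψ))
  | Q1 (r : QI) (φ ψ : QForm) :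
      Prov (liff (nabla r (imp φ ψ)) (imp (nabla r φ) (nabla r ψ)))
  | Q2 (r q : QI) (φ : QForm) :
      Prov (liff (nabla (QI.odot r (QI.star q)) φ) (imp (nabla q φ) (nabla r φ)))
  | Q3 (r q : QI) (φ : QForm) :
      Prov (liff (nabla r (nabla q φ)) (nabla (QI.mul r q) φ))
  | Q4 (φ : QForm) : Prov (liff (nabla QI.one φ) φ)
  | MP (φ ψ : QForm) : Prov φ → Prov (imp φ ψ) → Prov ψ

end QForm

/-- An evaluation of `𝒬Ł`-formulas in a DMV-algebra `A`. -/
def IsEval {A : Type} [DMVAlgebra A] (e : QForm → A) : Prop :=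
  (∀ φ ψ : QForm, e (QForm.imp φ ψ) =
      MVAlgebra.oplus (MVAlgebra.star (e φ)) (e ψ)) ∧
  (∀ φ : QForm, e (QForm.neg φ) = MVAlgebra.star (e φ)) ∧
  (∀ (r : QI) (φ : QForm), e (QForm.nabla r φ) =
      MVAlgebra.star (DMVAlgebra.smul r (MVAlgebra.star (e φ))))

/-- An evaluation of `𝒬Ł`-formulas in the standard DMV-algebra `[0,1] ∩ ℚ`
(where the scalar action is multiplication). -/
def IsEvalQ (e : QForm → QI) : Prop :=
  (∀ φ ψ : QForm, e (QForm.imp φ ψ) = QI.oplus (QI.star (e φ)) (e ψ)) ∧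
  (∀ φ : QForm, e (QForm.neg φ) = QI.star (e φ)) ∧
  (∀ (r : QI) (φ : QForm), e (QForm.nabla r φ) =
      QI.star (QI.mul r (QI.star (e φ))))

/-- Provable equivalence of formulas, defining the Lindenbaum–Tarski algebra. -/
def ProvEquiv (φ ψ : QForm) : Prop :=
  QForm.Prov (QForm.imp φ ψ) ∧ QForm.Prov (QForm.imp ψ φ)


namespace QLProof

local prefix:max "∼" => MVAlgebra.star

section MV
variable {A : Type} [MVAlgebra A]

instance instACM : AddCommMonoid A where
  add := MVAlgebra.oplus
  zero := MVAlgebra.zero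
  add_assoc := MVAlgebra.oplus_assoc
  add_comm := MVAlgebra.oplus_comm
  add_zero := MVAlgebra.oplus_zero
  zero_add x := (MVAlgebra.oplus_comm _ _).trans (MVAlgebra.oplus_zero x)
  nsmul n x := Nat.rec MVAlgebra.zero (fun _ y => MVAlgebra.oplus y x) n
  nsmul_zero _ := rfl
  nsmul_succ _ _ := rfl

instance instOne : One A := ⟨MVAlgebra.one⟩

theorem oplus_eq (x y : A) : MVAlgebra.oplus x y = x + y := rfl
theorem zero_eq : (MVAlgebra.zero : A) = 0 := rfl
theorem one_eq : (MVAlgebra.one : A) = 1 := rfl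
theorem odot_eq (x y : A) : MVAlgebra.odot x y = ∼(∼x + ∼y) := rfl

@[simp] theorem nn (x : A) : ∼∼x = x := MVAlgebra.star_star x
@[simp] theorem n0 : ∼(0 : A) = 1 := rfl
@[simp] theorem n1 : ∼(1 : A) = 0 := nn (0 : A)
@[simp] theorem one_add' (x : A) : 1 + x = 1 := MVAlgebra.oplus_star_zero x
@[simp] theorem add_one' (x : A) : x + 1 = 1 := by rw [add_comm, one_add']
theorem luk (x y : A) : ∼(∼x + y) + y = ∼(∼y + x) + x := MVAlgebra.lukasiewicz x y
theorem n_inj {x y : A} (h : ∼x = ∼y) : x = y := by rw [← nn x, h, nn]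
@[simp] theorem n_add_self (x : A) : ∼x + x = 1 := by
  have := luk (1 : A) x
  simpa using this
@[simp] theorem add_n_self (x : A) : x + ∼x = 1 := by rw [add_comm, n_add_self]

instance instPO : PartialOrder A where
  le x y := ∼x + y = 1
  le_refl x := n_add_self x
  le_antisymm x y h1 h2 := by
    have := luk x y
    change ∼x + y = 1 at h1
    change ∼y + x = 1 at h2
    rw [h1, h2] at this
    simpa using this.symm
  le_trans x y z h1 h2 := by
    change ∼x + y = 1 at h1
    change ∼y + z = 1 at h2
    have e : z = ∼(∼z + y) + y := by
      have := luk y z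
      rw [h2] at this; simpa using this
    rw [e, add_left_comm, h1]; simp

theorem le_def (x y : A) : x ≤ y ↔ ∼x + y = 1 := Iff.rfl

theorem le_add (x y : A) : x ≤ x + y := by
  rw [le_def, ← add_assoc]; simp

theorem le_iff_ex (x y : A) : x ≤ y ↔ ∃ z, y = x + z := by
  constructor
  · intro h
    refine ⟨∼(∼y + x), ?_⟩
    have := luk x y
    rw [(le_def x y).1 h] at this
    rw [add_comm x]; simpa using this
  · rintro ⟨z, rfl⟩
    exact le_add x z

instance instOrd : IsOrderedAddMonoid A where
  add_le_add_left a b h c := by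
    obtain ⟨z, rfl⟩ := (le_iff_ex a b).1 h
    rw [add_right_comm]
    exact le_add _ _

theorem zero_le' (x : A) : 0 ≤ x := by rw [le_def]; simp
theorem le_one' (x : A) : x ≤ 1 := by rw [le_def]; simp
theorem n_anti {x y : A} (h : x ≤ y) : ∼y ≤ ∼x := by
  rw [le_def] at *; rw [nn, add_comm]; exact h

theorem le_zero' {x : A} (h : x ≤ 0) : x = 0 := le_antisymm h (zero_le' x)
theorem one_le' {x : A} (h : 1 ≤ x) : x = 1 := le_antisymm (le_one' x) h

/-- truncated difference -/
def sb (x y : A) : A := ∼(∼x + y)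

theorem odot_n (x y : A) : MVAlgebra.odot x ∼y = sb x y := by
  rw [odot_eq, nn]; rfl

theorem sb_zero_iff (x y : A) : sb x y = 0 ↔ x ≤ y := by
  unfold sb
  rw [le_def]
  constructor
  · intro h; apply n_inj; rw [h]; simp
  · intro h; rw [h]; simp

theorem sb_mono {x y z : A} (h : x ≤ y) : sb x z ≤ sb y z :=
  n_anti (add_le_add_left (n_anti h) z)

theorem sb_add_eq {x y : A} (h : y ≤ x) : sb x y + y = x := by
  unfold sb
  rw [luk, (le_def _ _).1 h]; simp

/-- `x` and `y` orthogonal: `x ≤ y*` -/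
theorem add_sb {x y : A} (h : x ≤ ∼y) : sb (x + y) y = x := by
  unfold sb
  apply n_inj
  rw [nn]
  have := luk (∼x) y
  rw [nn] at this
  rw [this, add_comm ∼y, (le_def _ _).1 h]; simp

theorem add_cancel' {x y z : A} (hx : x ≤ ∼z) (hy : y ≤ ∼z) (h : x + z ≤ y + z) : x ≤ y := by
  rw [← add_sb hx, ← add_sb hy]
  exact sb_mono h

theorem le_sup_r (x y : A) : y ≤ sb x y + y := by
  rw [add_comm]; exact le_add _ _

theorem sup_comm' (x y : A) : sb x y + y = sb y x + x := luk x y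

theorem le_sup_l (x y : A) : x ≤ sb x y + y := by
  rw [sup_comm']; exact le_sup_r _ _

theorem sup_le' {x y z : A} (hx : x ≤ z) (hy : y ≤ z) : sb x y + y ≤ z := by
  calc sb x y + y ≤ sb z y + y := add_le_add_left (sb_mono hx) y
    _ = z := sb_add_eq hy

theorem sb_le_n (x y : A) : sb x y ≤ ∼y := n_anti (by rw [add_comm]; exact le_add _ _)

theorem le_n_symm {x y : A} (h : x ≤ ∼y) : y ≤ ∼x := by
  have := n_anti h
  rwa [nn] at this

theorem prelin {x y q : A} (h1 : q ≤ sb x y) (h2 : q ≤ sb y x) : q = 0 := by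
  have hy : q ≤ ∼y := h1.trans (sb_le_n x y)
  have hx : q ≤ ∼x := h2.trans (sb_le_n y x)
  set s := sb x y + y with hs
  have a1 : y + q ≤ s := by
    rw [add_comm]; exact add_le_add_left h1 y
  have a2 : x + q ≤ s := by
    rw [add_comm, hs, sup_comm']; exact add_le_add_left h2 x
  have b1 : y ≤ sb s q := by
    rw [← add_sb (le_n_symm hy)]; exact sb_mono a1
  have b2 : x ≤ sb s q := by
    rw [← add_sb (le_n_symm hx)]; exact sb_mono a2
  have c : s ≤ sb s q := sup_le' b2 b1
  have d : s + q ≤ s := by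
    calc s + q ≤ sb s q + q := add_le_add_left c q
      _ = s := sb_add_eq (le_trans (by rw [add_comm]; exact le_add _ _) a1)
  have e : s ≤ ∼q := sup_le' (le_n_symm hx) (le_n_symm hy)
  apply le_zero'
  apply add_cancel' (z := s) (le_n_symm e) (zero_le' _)
  rw [add_comm, zero_add]; exact d

theorem prelin_one {x y p : A} (h1 : sb x y + p = 1) (h2 : sb y x + p = 1) : p = 1 := by
  have : ∼p = 0 := by
    apply prelin (x := x) (y := y)
    · rw [le_def, nn, add_comm]; exact h1
    · rw [le_def, nn, add_comm]; exact h2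
  apply n_inj; rw [this, n1]

theorem prelin_pow1 {x y p : A} (m : ℕ) (h1 : sb x y + p = 1)
    (h2 : m • sb y x + p = 1) : p = 1 := by
  induction m with
  | zero => simpa using h2
  | succ m ih =>
    apply ih
    apply prelin_one (x := x) (y := y)
    · rw [add_left_comm, h1]; simp
    · rw [← h2, succ_nsmul]; abel

theorem prelin_pow {x y p : A} (n m : ℕ) (h1 : n • sb x y + p = 1)
    (h2 : m • sb y x + p = 1) : p = 1 := by
  induction n with
  | zero => simpa using h1
  | succ n ih =>
    apply ih
    apply prelin_pow1 (x := x) (y := y) m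
    · rw [← h1, succ_nsmul]; abel
    · rw [add_left_comm, h2]; simp

end MV

section Sound
variable {A : Type} [DMVAlgebra A]

theorem sound {e : QForm → A} (he : IsEval e) {φ : QForm} (h : QForm.Prov φ) : e φ = 1 := by
  obtain ⟨hi, hn, hd⟩ := he
  simp only [oplus_eq] at hi
  have hiff : ∀ {φ ψ}, e φ = e ψ → e (QForm.liff φ ψ) = 1 := by
    intro φ ψ h
    simp [QForm.liff, hi, hn, h]
  have smul_sb : ∀ (r : QI) (x y : A), DMVAlgebra.smul r (sb x y) =
      sb (DMVAlgebra.smul r x) (DMVAlgebra.smul r y) := by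
    intro r x y
    rw [← odot_n, DMVAlgebra.smul_odot, odot_n]
  induction h with
  | L1 φ ψ => simp only [hi]; rw [add_left_comm]; simp
  | L2 φ ψ χ =>
    simp only [hi]
    have : ∼(∼(e ψ) + e χ) + (∼(e φ) + e χ) = ∼(e φ) + (∼(∼(e χ) + e ψ) + e ψ) := by
      rw [← luk (e ψ)]; abel
    rw [this, add_left_comm ∼(e φ), add_left_comm]; simp
  | L3 φ ψ => simp only [hi, QForm.lor]; rw [luk (e φ)]; simp
  | L4 φ ψ => simp only [hi, hn, nn]; rw [add_comm (e ψ)]; simp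
  | Q1 r φ ψ =>
    apply hiff
    simp only [hi, hd, nn]
    apply n_inj
    rw [nn]
    have := smul_sb r (∼(e ψ)) (∼(e φ))
    simp only [sb, nn] at this
    rw [add_comm ∼(e φ), this, add_comm]
  | Q2 r q φ =>
    apply hiff
    simp only [hi, hd, nn]
    rw [DMVAlgebra.odot_smul, odot_n, sb, nn, add_comm]
  | Q3 r q φ =>
    apply hiff
    simp only [hd, nn, DMVAlgebra.smul_smul]
  | Q4 φ =>
    apply hiff
    simp only [hd, DMVAlgebra.one_smul, nn]
  | MP φ ψ _ _ h1 h2 =>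
    rw [hi, h1] at h2
    simpa using h2

end Sound

theorem QI.star_val (r : QI) : (QI.star r).1 = 1 - r.1 := rfl
theorem QI.oplus_val (r s : QI) : (QI.oplus r s).1 = min (r.1 + s.1) 1 := rfl
theorem QI.mul_val (r s : QI) : (QI.mul r s).1 = r.1 * s.1 := rfl
theorem QI.zero_val : QI.zero.1 = 0 := rfl
theorem QI.one_val : QI.one.1 = 1 := rfl
theorem QI.ext' {r s : QI} (h : r.1 = s.1) : r = s := Subtype.ext h

@[reducible] def qiMV : MVAlgebra QI where
  oplus := QI.oplus
  star := QI.star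
  zero := QI.zero
  oplus_assoc x y z := by
    apply QI.ext'; simp only [QI.oplus_val]
    have := x.2; have := y.2; have := z.2
    grind
  oplus_comm x y := by
    apply QI.ext'; simp only [QI.oplus_val]; rw [add_comm]
  oplus_zero x := by
    apply QI.ext'; simp only [QI.oplus_val, QI.zero_val]; simp [x.2.2]
  star_star x := by
    apply QI.ext'; simp [QI.star_val]
  lukasiewicz x y := by
    apply QI.ext'; simp only [QI.oplus_val, QI.star_val]
    have := x.2; have := y.2
    grind
  oplus_star_zero x := by
    apply QI.ext'; simp only [QI.oplus_val, QI.star_val, QI.zero_val]; simp [x.2.1]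

theorem QI.odot_star_val (r s : QI) : (QI.odot r (QI.star s)).1 = max (r.1 - s.1) 0 := by
  simp only [QI.odot, QI.oplus_val, QI.star_val]
  grind

@[reducible] def qiDMV : DMVAlgebra QI where
  toMVAlgebra := qiMV
  smul := QI.mul
  smul_odot r x y := by
    change QI.mul r (QI.odot x (QI.star y)) = QI.odot (QI.mul r x) (QI.star (QI.mul r y))
    apply QI.ext'
    simp only [QI.odot_star_val, QI.mul_val]
    rw [mul_max_of_nonneg _ _ r.2.1]; congr 1 <;> ring
  odot_smul r q x := by
    change QI.mul (QI.odot r (QI.star q)) x = QI.odot (QI.mul r x) (QI.star (QI.mul q x))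
    apply QI.ext'
    simp only [QI.odot_star_val, QI.mul_val]
    rw [max_mul_of_nonneg _ _ x.2.1]; congr 1 <;> ring
  smul_smul r q x := by
    apply QI.ext'; simp only [QI.mul_val]; ring
  one_smul x := by
    apply QI.ext'; simp [QI.mul_val, QI.one_val]

/-- theories: sets of formulas containing theorems and closed under MP -/
structure Th (T : QForm → Prop) : Prop where
  prov : ∀ {φ}, QForm.Prov φ → T φ
  mp : ∀ {φ ψ}, T φ → T (φ.imp ψ) → T ψ

local infixr:60 "⇒" => QForm.imp

namespace Th
open QForm
variable {T : QForm → Prop}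
variable {φ ψ χ θ : QForm}

theorem L1 (h : Th T) (φ ψ) : T (φ ⇒ ψ ⇒ φ) := h.prov (.L1 _ _)
theorem L2 (h : Th T) (φ ψ χ) : T ((φ ⇒ ψ) ⇒ (ψ ⇒ χ) ⇒ (φ ⇒ χ)) := h.prov (.L2 _ _ _)
theorem tr (h : Th T) (a : T (φ ⇒ ψ)) (b : T (ψ ⇒ χ)) : T (φ ⇒ χ) := h.mp b (h.mp a (h.L2 _ _ _))
theorem asrt (h : Th T) (φ ψ) : T (φ ⇒ (φ ⇒ ψ) ⇒ ψ) := h.tr (h.L1 φ (ψ ⇒ φ)) (h.prov (.L3 _ _))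
theorem suf (h : Th T) (χ) (a : T (φ ⇒ ψ)) : T ((ψ ⇒ χ) ⇒ (φ ⇒ χ)) := h.mp a (h.L2 _ _ _)
theorem exch (h : Th T) (φ ψ χ) : T ((φ ⇒ ψ ⇒ χ) ⇒ (ψ ⇒ φ ⇒ χ)) :=
  h.tr (h.L2 φ (ψ ⇒ χ) χ) (h.suf _ (h.asrt ψ χ))
theorem ex (h : Th T) (a : T (φ ⇒ ψ ⇒ χ)) : T (ψ ⇒ φ ⇒ χ) := h.mp a (h.exch _ _ _)
theorem id (h : Th T) (φ) : T (φ ⇒ φ) := h.mp (h.L1 φ φ) (h.ex (h.L1 φ (φ ⇒ φ ⇒ φ)))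
theorem B (h : Th T) (φ ψ χ) : T ((ψ ⇒ χ) ⇒ (φ ⇒ ψ) ⇒ (φ ⇒ χ)) := h.ex (h.L2 _ _ _)
theorem pre (h : Th T) (χ) (a : T (φ ⇒ ψ)) : T ((χ ⇒ φ) ⇒ (χ ⇒ ψ)) := h.mp a (h.B _ _ _)
theorem efq (h : Th T) (φ ψ) : T (φ.neg ⇒ φ ⇒ ψ) := h.tr (h.L1 _ ψ.neg) (h.prov (.L4 _ _))
theorem dne (h : Th T) (φ) : T (φ.neg.neg ⇒ φ) :=
  h.mp (h.id φ) (h.ex (h.tr (h.efq φ.neg (φ ⇒ φ).neg) (h.prov (.L4 _ _))))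
theorem dni (h : Th T) (φ) : T (φ ⇒ φ.neg.neg) := h.mp (h.dne φ.neg) (h.prov (.L4 _ _))
theorem ctr (h : Th T) (φ ψ) : T ((φ ⇒ ψ) ⇒ (ψ.neg ⇒ φ.neg)) :=
  h.tr (h.tr (h.suf ψ (h.dne φ)) (h.pre _ (h.dni ψ))) (h.prov (.L4 _ _))
theorem ct (h : Th T) (a : T (φ ⇒ ψ)) : T (ψ.neg ⇒ φ.neg) := h.mp a (h.ctr _ _)
theorem weak (h : Th T) (φ) (a : T ψ) : T (φ ⇒ ψ) := h.mp a (h.L1 _ _)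
theorem iffl (h : Th T) (a : T (liff φ ψ)) : T (φ ⇒ ψ) :=
  h.mp a (h.tr (h.ct (h.efq (φ ⇒ ψ) (ψ ⇒ φ).neg)) (h.dne _))
theorem iffr (h : Th T) (a : T (liff φ ψ)) : T (ψ ⇒ φ) :=
  h.mp a (h.tr (h.ct (h.L1 (ψ ⇒ φ).neg (φ ⇒ ψ))) (h.dne _))

theorem nec0 (h : Th T) (r : QI) (φ) : T (φ ⇒ nabla r φ) := by
  have q2 := h.prov (QForm.Prov.Q2 QI.one (QI.star r) φ)
  have e : QI.odot QI.one (QI.star (QI.star r)) = r := by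
    apply QI.ext'
    rw [QI.odot_star_val]
    simp [QI.star_val, QI.one_val, r.2.1]
  rw [e] at q2
  refine h.tr ?_ (h.iffr q2)
  exact h.tr (h.iffr (h.prov (.Q4 φ))) (h.L1 _ _)

theorem nab (h : Th T) (r : QI) (a : T (φ ⇒ ψ)) : T (nabla r φ ⇒ nabla r ψ) :=
  h.mp (h.mp a (h.nec0 r _)) (h.iffl (h.prov (.Q1 _ _ _)))

/-- equivalence -/
def setoid (h : Th T) : Setoid QForm where
  r φ ψ := T (φ ⇒ ψ) ∧ T (ψ ⇒ φ)
  iseqv := ⟨fun φ => ⟨h.id φ, h.id φ⟩, fun a => ⟨a.2, a.1⟩,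
    fun a b => ⟨h.tr a.1 b.1, h.tr b.2 a.2⟩⟩

abbrev Q (h : Th T) : Type := Quotient h.setoid

def I (h : Th T) : h.Q → h.Q → h.Q := Quotient.map₂ QForm.imp (by
  rintro a b ⟨h1, h2⟩ c d ⟨h3, h4⟩
  exact ⟨h.tr (h.suf _ h2) (h.pre _ h3), h.tr (h.suf _ h1) (h.pre _ h4)⟩)

def N (h : Th T) : h.Q → h.Q := Quotient.map QForm.neg (by
  rintro a b ⟨h1, h2⟩
  exact ⟨h.ct h2, h.ct h1⟩)

def D (h : Th T) (r : QI) : h.Q → h.Q := Quotient.map (QForm.nabla r) (by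
  rintro a b ⟨h1, h2⟩
  exact ⟨h.nab r h1, h.nab r h2⟩)

theorem NN (h : Th T) (x : h.Q) : h.N (h.N x) = x := by
  induction x using Quotient.inductionOn with | _ φ =>
  exact Quotient.sound ⟨h.dne φ, h.dni φ⟩

theorem IN (h : Th T) (x y : h.Q) : h.I (h.N y) (h.N x) = h.I x y := by
  induction x using Quotient.inductionOn with | _ φ =>
  induction y using Quotient.inductionOn with | _ ψ =>
  exact Quotient.sound ⟨h.prov (.L4 _ _), h.ctr _ _⟩

theorem Iex (h : Th T) (x y z : h.Q) : h.I x (h.I y z) = h.I y (h.I x z) := by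
  induction x using Quotient.inductionOn with | _ φ =>
  induction y using Quotient.inductionOn with | _ ψ =>
  induction z using Quotient.inductionOn with | _ χ =>
  exact Quotient.sound ⟨h.exch _ _ _, h.exch _ _ _⟩

theorem Iluk (h : Th T) (x y : h.Q) : h.I (h.I x y) y = h.I (h.I y x) x := by
  induction x using Quotient.inductionOn with | _ φ =>
  induction y using Quotient.inductionOn with | _ ψ =>
  exact Quotient.sound ⟨h.prov (.L3 _ _), h.prov (.L3 _ _)⟩

def O (h : Th T) : h.Q := Quotient.mk h.setoid (QForm.var 0 ⇒ QForm.var 0)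

theorem mk_eq_O (h : Th T) {φ : QForm} : Quotient.mk h.setoid φ = h.O ↔ T φ := by
  constructor
  · intro a
    exact h.mp (h.id _) (Quotient.exact a).2
  · intro a
    exact Quotient.sound ⟨h.weak _ (h.id _), h.weak _ a⟩

theorem OI (h : Th T) (x : h.Q) : h.I h.O x = x := by
  induction x using Quotient.inductionOn with | _ φ =>
  exact Quotient.sound ⟨h.mp (h.id (.var 0)) (h.asrt _ _), h.L1 _ _⟩

theorem NOI (h : Th T) (x : h.Q) : h.I (h.N h.O) x = h.O := by
  induction x using Quotient.inductionOn with | _ φ =>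
  apply h.mk_eq_O.2
  exact h.mp (h.id (.var 0)) (h.ex (h.efq _ _))

theorem Icomm (h : Th T) (x y : h.Q) : h.I (h.N x) y = h.I (h.N y) x := by
  rw [← h.IN, h.NN]

@[reducible] def mv (h : Th T) : MVAlgebra h.Q where
  oplus x y := h.I (h.N x) y
  star := h.N
  zero := h.N h.O
  oplus_comm := h.Icomm
  oplus_assoc x y z := by
    rw [h.Icomm _ z, h.Iex, h.Icomm z]
  oplus_zero x := by
    rw [h.Icomm, h.NN, h.OI]
  star_star := h.NN
  lukasiewicz x y := by
    simp only [h.NN]; exact h.Iluk x y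
  oplus_star_zero x := by
    simp only [h.NN]; exact h.NOI x

@[reducible] def dmv (h : Th T) : DMVAlgebra h.Q where
  toMVAlgebra := h.mv
  smul r x := h.N (h.D r (h.N x))
  smul_odot r x y := by
    change h.N (h.D r (h.N (h.N (h.I (h.N (h.N x)) (h.N (h.N y)))))) =
      h.N (h.I (h.N (h.N (h.N (h.D r (h.N x))))) (h.N (h.N (h.N (h.D r (h.N y))))))
    simp only [h.NN]
    rw [h.IN]
    congr 1
    rw [← h.IN]
    generalize h.N x = x
    generalize h.N y = y
    induction x using Quotient.inductionOn with | _ φ =>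
    induction y using Quotient.inductionOn with | _ ψ =>
    have := h.prov (QForm.Prov.Q1 r ψ φ)
    exact Quotient.sound ⟨h.iffl this, h.iffr this⟩
  odot_smul r q x := by
    change h.N (h.D _ (h.N x)) =
      h.N (h.I (h.N (h.N (h.N (h.D r (h.N x))))) (h.N (h.N (h.N (h.D q (h.N x))))))
    simp only [h.NN]
    rw [h.IN]
    congr 1
    generalize h.N x = x
    induction x using Quotient.inductionOn with | _ φ =>
    have := h.prov (QForm.Prov.Q2 r q φ)
    exact Quotient.sound ⟨h.iffl this, h.iffr this⟩
  smul_smul r q x := by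
    simp only [h.NN]
    congr 1
    generalize h.N x = x
    induction x using Quotient.inductionOn with | _ φ =>
    have := h.prov (QForm.Prov.Q3 r q φ)
    exact Quotient.sound ⟨h.iffl this, h.iffr this⟩
  one_smul x := by
    conv_rhs => rw [← h.NN x]
    congr 1
    generalize h.N x = x
    induction x using Quotient.inductionOn with | _ φ =>
    have := h.prov (QForm.Prov.Q4 φ)
    exact Quotient.sound ⟨h.iffl this, h.iffr this⟩

instance instQ (h : Th T) : DMVAlgebra h.Q := h.dmv

def ev (h : Th T) (φ : QForm) : h.Q := Quotient.mk h.setoid φ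

theorem ev_isEval (h : Th T) : IsEval h.ev := by
  refine ⟨fun φ ψ => ?_, fun φ => rfl, fun r φ => ?_⟩
  · change h.I (h.ev φ) (h.ev ψ) = h.I (h.N (h.N _)) _
    rw [h.NN]
  · change h.D r (h.ev φ) = h.N (h.N (h.D r (h.N (h.N _))))
    simp only [h.NN]

theorem ev_one (h : Th T) : h.ev φ = 1 ↔ T φ := by
  rw [← h.mk_eq_O]
  have : (1 : h.Q) = h.O := h.NN h.O
  rw [this]; rfl

theorem ev_le (h : Th T) : h.ev φ ≤ h.ev ψ ↔ T (φ ⇒ ψ) := by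
  rw [le_def, ← h.ev_one, h.ev_isEval.1]; rfl

end Th

theorem th_prov : Th QForm.Prov := ⟨fun h => h, fun a b => .MP _ _ a b⟩

/-- iterated implication -/
def imps (α : QForm) : ℕ → QForm → QForm
  | 0, χ => χ
  | n + 1, χ => α ⇒ imps α n χ

theorem ev_imps {T} (h : Th T) (α χ : QForm) (n : ℕ) :
    h.ev (imps α n χ) = n • ∼(h.ev α) + h.ev χ := by
  induction n with
  | zero => simp [imps]
  | succ n ih =>
    rw [imps, h.ev_isEval.1, ih, oplus_eq, succ_nsmul]; abel

theorem adjoin {T} (h : Th T) (α : QForm) : Th (fun χ => ∃ n, T (imps α n χ)) where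
  prov a := ⟨0, h.prov a⟩
  mp := by
    rintro φ ψ ⟨n, hn⟩ ⟨m, hm⟩
    refine ⟨n + m, ?_⟩
    rw [← h.ev_one, ev_imps] at *
    rw [h.ev_isEval.1, oplus_eq] at hm
    have : h.ev φ ≤ m • ∼(h.ev α) + h.ev ψ := by
      rw [le_def, ← hm]; abel
    apply one_le'
    rw [add_nsmul, ← hn, add_assoc]
    exact add_le_add_right this _

theorem exists_prime {φ : QForm} (hφ : ¬ QForm.Prov φ) :
    ∃ T, Th T ∧ ¬ T φ ∧ ∀ α β, T (α ⇒ β) ∨ T (β ⇒ α) := by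
  obtain ⟨S, hS⟩ := zorn_subset {S : Set QForm | Th (fun x => x ∈ S) ∧ φ ∉ S} (by
    intro c hc hch
    by_cases hne : c.Nonempty
    · refine ⟨⋃₀ c, ⟨⟨?_, ?_⟩, ?_⟩, fun s hs => Set.subset_sUnion_of_mem hs⟩
      · intro ψ hψ
        obtain ⟨s, hs⟩ := hne
        exact ⟨s, hs, (hc hs).1.prov hψ⟩
      · rintro ψ χ ⟨s, hs, h1⟩ ⟨t, ht, h2⟩
        rcases hch.total hs ht with h | h
        · exact ⟨t, ht, (hc ht).1.mp (h h1) h2⟩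
        · exact ⟨s, hs, (hc hs).1.mp h1 (h h2)⟩
      · rintro ⟨s, hs, h⟩
        exact (hc hs).2 h
    · rw [Set.not_nonempty_iff_eq_empty] at hne
      subst hne
      exact ⟨{x | QForm.Prov x}, ⟨th_prov, hφ⟩, by simp⟩)
  obtain ⟨⟨hT, hn⟩, hmax⟩ := hS
  refine ⟨fun x => x ∈ S, hT, hn, ?_⟩
  have key : ∀ α, α ∉ S → ∃ n, imps α n φ ∈ S := by
    intro α hα
    by_contra hcon
    have := hmax (y := {χ | ∃ n, imps α n χ ∈ S}) ⟨adjoin hT α, hcon⟩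
      (fun x hx => ⟨0, hx⟩)
    exact hα (this ⟨1, hT.id α⟩)
  intro α β
  by_contra hcon
  push Not at hcon
  obtain ⟨n, hn1⟩ := key _ hcon.1
  obtain ⟨m, hm1⟩ := key _ hcon.2
  have e1 := (hT.ev_one).2 hn1
  have e2 := (hT.ev_one).2 hm1
  rw [ev_imps, hT.ev_isEval.1, oplus_eq] at e1 e2
  exact hn (hT.ev_one.1 (prelin_pow (x := hT.ev α) (y := hT.ev β) n m e1 e2))


section Farkas
variable {V : Type} [AddCommGroup V] [Module ℚ V]

theorem farkas (P : V → Prop) (P0 : P 0) (Padd : ∀ x y, P x → P y → P (x + y))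
    (Psmul : ∀ (c : ℚ) x, 0 ≤ c → P x → P (c • x)) :
    ∀ (n : ℕ) (F : List V) (b : V), F.length = n → (∀ v ∈ F, P v) → ¬ P b →
      ∃ f : V →ₗ[ℚ] ℚ, (∀ v ∈ F, 0 ≤ f v) ∧ f b < 0 := by
  intro n
  induction n with
  | zero =>
    intro F b hF _ hb
    have hb0 : b ≠ 0 := by rintro rfl; exact hb P0
    obtain ⟨f, hf⟩ := Module.Projective.exists_dual_eq_one ℚ hb0
    refine ⟨-f, ?_, ?_⟩
    · have : F = [] := List.length_eq_zero_iff.1 hF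
      simp [this]
    · simp [hf]
  | succ n ih =>
    intro F b hF hP hb
    obtain ⟨w, F, rfl⟩ := List.exists_cons_of_length_eq_add_one hF
    have hF' : F.length = n := by simpa using hF
    have hPw : P w := hP w (by simp)
    have hPF : ∀ v ∈ F, P v := fun v hv => hP v (by simp [hv])
    obtain ⟨f, hf, hfb⟩ := ih F b hF' hPF hb
    by_cases hw : 0 ≤ f w
    · refine ⟨f, ?_, hfb⟩
      intro v hv
      rcases List.mem_cons.1 hv with rfl | hv
      · exact hw
      · exact hf v hv
    · push Not at hw
      let π : V →ₗ[ℚ] V := LinearMap.id - (f.smulRight ((f w)⁻¹ • w))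
      have hπ : ∀ x, π x = x - (f x * (f w)⁻¹) • w := by
        intro x; simp [π, smul_smul]
      obtain ⟨g, hg, hgb⟩ := ih (F.map π) (π b) (by simpa using hF') (by
        intro v hv
        obtain ⟨u, hu, rfl⟩ := List.mem_map.1 hv
        rw [hπ, sub_eq_add_neg, ← neg_smul]
        apply Padd _ _ (hPF u hu) (Psmul _ _ _ hPw)
        have : (f w)⁻¹ < 0 := inv_lt_zero.2 hw
        nlinarith [hf u hu]) (by
        intro hcon
        apply hb
        have : b = π b + (f b * (f w)⁻¹) • w := by rw [hπ]; abel
        rw [this]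
        apply Padd _ _ hcon (Psmul _ _ _ hPw)
        have : (f w)⁻¹ < 0 := inv_lt_zero.2 hw
        nlinarith)
      refine ⟨g.comp π, ?_, hgb⟩
      intro v hv
      rcases List.mem_cons.1 hv with rfl | hv
      · have : π v = 0 := by
          rw [hπ, mul_inv_cancel₀ hw.ne]; simp
        simp [this]
      · exact hg _ (List.mem_map_of_mem hv)

end Farkas

section DMV
set_option linter.unusedSectionVars false
variable {A : Type} [DMVAlgebra A]

abbrev d (r : QI) (x : A) : A := DMVAlgebra.smul r x

theorem d_sb (r : QI) (x y : A) : d r (sb x y) = sb (d r x) (d r y) := by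
  rw [← odot_n, ← odot_n]; exact DMVAlgebra.smul_odot r x y

theorem sb_d (r q s : QI) (x : A) (h : s.1 = max (r.1 - q.1) 0) :
    d s x = sb (d r x) (d q x) := by
  have : s = QI.odot r (QI.star q) := QI.ext' (by rw [h, QI.odot_star_val])
  rw [this, ← odot_n]; exact DMVAlgebra.odot_smul r q x

theorem d_zero (r : QI) : d r (0 : A) = 0 := by
  have h : (0 : A) = sb 0 0 := ((sb_zero_iff _ _).2 le_rfl).symm
  rw [h, d_sb]; rw [(sb_zero_iff _ _).2 le_rfl, (sb_zero_iff _ _).2 le_rfl]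

theorem zero_d (r : QI) (h : r.1 = 0) (x : A) : d r x = 0 := by
  rw [sb_d r r r x (by simp [h])]; exact (sb_zero_iff _ _).2 le_rfl

theorem d_mono (r : QI) {x y : A} (h : x ≤ y) : d r x ≤ d r y := by
  rw [← sb_zero_iff, ← d_sb, (sb_zero_iff _ _).2 h, d_zero]

theorem d_mono_l {r q : QI} (h : r.1 ≤ q.1) (x : A) : d r x ≤ d q x := by
  rw [← sb_zero_iff, ← sb_d r q QI.zero x (by simp [h, QI.zero_val]), zero_d _ rfl]

theorem d_add (r : QI) {x y : A} (h : x ≤ ∼y) : d r (x + y) = d r x + d r y := by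
  have h1 : d r x = sb (d r (x + y)) (d r y) := by rw [← d_sb, add_sb h]
  rw [h1, sb_add_eq]
  apply d_mono
  rw [add_comm]; exact le_add _ _

theorem add_d {r q s : QI} (h : s.1 = r.1 + q.1) (x : A) : d s x = d r x + d q x := by
  have h1 : d r x = sb (d s x) (d q x) := sb_d _ _ _ _ (by rw [h]; simp [r.2.1])
  rw [h1, sb_add_eq]
  apply d_mono_l
  rw [h]; linarith [r.2.1]

theorem d_orth {r q : QI} (h : r.1 + q.1 ≤ 1) (x : A) : d r x ≤ ∼(d q x) := by
  let s : QI := ⟨r.1 + q.1, add_nonneg r.2.1 q.2.1, h⟩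
  have h1 : d r x = sb (d s x) (d q x) := sb_d _ _ _ _ (by simp [s, r.2.1])
  rw [h1]; exact sb_le_n _ _

theorem d_d (r q s : QI) (h : s.1 = r.1 * q.1) (x : A) : d r (d q x) = d s x := by
  have : s = QI.mul r q := QI.ext' h
  rw [this]; exact DMVAlgebra.smul_smul r q x

theorem oneOver_val (N : ℕ) : (QI.oneOver N).1 = 1 / N := rfl

theorem one_d (x : A) (s : QI) (h : s.1 = 1) : d s x = x := by
  have : s = QI.one := QI.ext' h
  rw [this]; exact DMVAlgebra.one_smul x

theorem nsmul_d (N : ℕ) (x : A) (k : ℕ) : ∀ s : QI, s.1 = k / N →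
    k • d (QI.oneOver N) x = d s x := by
  induction k with
  | zero => intro s h; rw [zero_d s (by simpa using h)]; simp
  | succ k ih =>
    intro s h
    have hk : (k : ℚ) / N ≤ 1 := by
      refine le_trans ?_ s.2.2
      rw [h]; gcongr; push_cast; linarith
    rw [succ_nsmul, ih ⟨k / N, by positivity, hk⟩ rfl]
    symm
    apply add_d
    rw [h, oneOver_val]; push_cast; ring

theorem d_eq_zero {r : QI} (hr : 0 < r.1) {x : A} (h : d r x = 0) : x = 0 := by
  obtain ⟨n, hn⟩ := exists_nat_one_div_lt hr
  have h1 : d (QI.oneOver (n + 1)) x = 0 := by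
    apply le_zero'; rw [← h]; apply d_mono_l
    rw [oneOver_val]; push_cast; exact hn.le
  rw [← one_d x QI.one rfl, ← nsmul_d (n + 1) x (n + 1) QI.one, h1]
  · simp
  · rw [QI.one_val]; field_simp

/-- scaled sum -/
def S (N : ℕ) (s : Multiset A) : A := (s.map (d (QI.oneOver N))).sum

theorem S_add (N : ℕ) (s t : Multiset A) : S N (s + t) = S N s + S N t := by simp [S]
theorem S_single (N : ℕ) (a : A) : S N {a} = d (QI.oneOver N) a := by simp [S]
theorem S_nsmul (N k : ℕ) (s : Multiset A) : S N (k • s) = k • S N s := by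
  induction k with
  | zero => simp [S]
  | succ k ih => rw [succ_nsmul, S_add, ih, succ_nsmul]

theorem S_le (N : ℕ) (s : Multiset A) : S N s ≤ s.card • d (QI.oneOver N) 1 := by
  induction s using Multiset.induction_on with
  | empty => simp [S]
  | cons a s ih =>
    rw [← Multiset.singleton_add, S_add, S_single, Multiset.card_add, Multiset.card_singleton,
      add_nsmul, one_nsmul]
    exact add_le_add (d_mono _ (le_one' a)) ih

theorem S_orth (N : ℕ) (s t : Multiset A) (hN : 0 < N) (h : s.card + t.card ≤ N) :
    S N s ≤ ∼(S N t) := by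
  have hN' : (0 : ℚ) < N := by exact_mod_cast hN
  have hq : (s.card : ℚ) + t.card ≤ N := by exact_mod_cast h
  have hs : (s.card : ℚ) / N ≤ 1 := by
    rw [div_le_one hN']; linarith [(Nat.cast_nonneg t.card : (0:ℚ) ≤ _)]
  have ht : (t.card : ℚ) / N ≤ 1 := by
    rw [div_le_one hN']; linarith [(Nat.cast_nonneg s.card : (0:ℚ) ≤ _)]
  have h1 := S_le N s
  have h2 := S_le N t
  rw [nsmul_d N 1 _ ⟨_, by positivity, hs⟩ rfl] at h1
  rw [nsmul_d N 1 _ ⟨_, by positivity, ht⟩ rfl] at h2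
  refine h1.trans (le_trans (d_orth ?_ 1) (n_anti h2))
  change (s.card : ℚ) / N + t.card / N ≤ 1
  rw [← add_div, div_le_one hN']; exact hq

open Filter

def L (s t : Multiset A) : Prop := ∀ᶠ N in atTop, S N s ≤ S N t

theorem L.add {s t s' t' : Multiset A} (h : L s t) (h' : L s' t') : L (s + s') (t + t') := by
  filter_upwards [h, h'] with N h1 h2
  rw [S_add, S_add]; exact add_le_add h1 h2

theorem L.refl (s : Multiset A) : L s s := Eventually.of_forall fun _ => le_rfl

theorem L.nsmul {s t : Multiset A} (k : ℕ) (h : L s t) : L (k • s) (k • t) := by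
  induction k with
  | zero => simpa using L.refl _
  | succ k ih => rw [succ_nsmul, succ_nsmul]; exact ih.add h

theorem L.cancel {s t u : Multiset A} (h : L (s + u) (t + u)) : L s t := by
  filter_upwards [h, eventually_ge_atTop (s.card + t.card + u.card + 1)] with N h1 h2
  rw [S_add, S_add] at h1
  exact add_cancel' (S_orth N s u (by omega) (by omega)) (S_orth N t u (by omega) (by omega)) h1

theorem L_one {a : A} {n : ℕ} (hn : 0 < n) (h : L (n • {1}) (n • {a})) : a = 1 := by
  obtain ⟨N, h1, h2⟩ := (h.and (eventually_ge_atTop n)).exists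
  have hN : (0 : ℚ) < N := by exact_mod_cast (by omega : 0 < N)
  have hle : (n : ℚ) / N ≤ 1 := by rw [div_le_one hN]; exact_mod_cast h2
  simp only [S_nsmul, S_single] at h1
  obtain ⟨r, hr'⟩ : ∃ r : QI, r.1 = n / N := ⟨⟨n / N, by positivity, hle⟩, rfl⟩
  rw [nsmul_d N _ n r hr', nsmul_d N _ n r hr'] at h1
  have : sb 1 a = 0 := by
    have hr : (0 : ℚ) < n / N := by positivity
    apply d_eq_zero (r := r)
    · rw [hr']; exact hr
    · rw [d_sb, sb_zero_iff]; exact h1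
  exact one_le' ((sb_zero_iff _ _).1 this)

open Classical in
noncomputable def iota : Multiset A →+ (A →₀ ℚ) :=
  (Finsupp.mapRange.addMonoidHom (Nat.castAddMonoidHom ℚ)).comp
    (Multiset.toFinsupp (α := A)).toAddMonoidHom

theorem iota_inj : Function.Injective (iota (A := A)) := by
  classical
  intro s t h
  apply Multiset.toFinsupp.injective
  exact Finsupp.mapRange_injective _ (by simp) Nat.cast_injective h

noncomputable abbrev sg (a : A) : A →₀ ℚ := Finsupp.single a 1

theorem iota_single (a : A) : iota {a} = sg a := by
  simp [iota, Multiset.toFinsupp_singleton]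

def P (v : A →₀ ℚ) : Prop :=
  ∃ (n : ℕ) (s t : Multiset A), 0 < n ∧ L s t ∧ (n : ℚ) • v = iota t - iota s

theorem P_of {s t : Multiset A} {v} (h : L s t) (hv : v = iota t - iota s) : P v :=
  ⟨1, s, t, one_pos, h, by rw [hv]; simp⟩

theorem P_zero : P (0 : A →₀ ℚ) := P_of (L.refl 0) (by simp)

theorem P_add (v w : A →₀ ℚ) (hv : P v) (hw : P w) : P (v + w) := by
  obtain ⟨n, s, t, hn, h, e⟩ := hv
  obtain ⟨m, s', t', hm, h', e'⟩ := hw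
  refine ⟨n * m, m • s + n • s', m • t + n • t', by positivity, (h.nsmul m).add (h'.nsmul n), ?_⟩
  have h1 : ((n * m : ℕ) : ℚ) • (v + w) = (m : ℚ) • ((n : ℚ) • v) + (n : ℚ) • ((m : ℚ) • w) := by
    push_cast; module
  rw [h1, e, e']
  simp only [map_add, map_nsmul, ← Nat.cast_smul_eq_nsmul ℚ]
  module

theorem P_smul (c : ℚ) (v : A →₀ ℚ) (hc : 0 ≤ c) (hv : P v) : P (c • v) := by
  obtain ⟨n, s, t, hn, h, e⟩ := hv
  refine ⟨n * c.den, c.num.toNat • s, c.num.toNat • t, by have := c.den_pos; positivity,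
    h.nsmul _, ?_⟩
  have hnum : ((c.num.toNat : ℕ) : ℚ) = c.den * c := by
    rw [Rat.den_mul_eq_num]
    have : ((c.num.toNat : ℕ) : ℤ) = c.num := Int.toNat_of_nonneg (Rat.num_nonneg.2 hc)
    exact_mod_cast this
  have h1 : ((n * c.den : ℕ) : ℚ) • (c • v) = (c.den * c : ℚ) • ((n : ℚ) • v) := by
    push_cast; module
  rw [h1, e, ← hnum]
  simp only [map_nsmul, ← Nat.cast_smul_eq_nsmul ℚ]
  module

theorem not_P {a : A} (h : P (sg a - sg 1)) : a = 1 := by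
  obtain ⟨n, s, t, hn, h, e⟩ := h
  apply L_one hn
  have e2 : t + n • {1} = s + n • {a} := by
    apply iota_inj
    simp only [map_add, map_nsmul, ← Nat.cast_smul_eq_nsmul ℚ, iota_single]
    rw [smul_sub] at e
    rw [← sub_eq_zero]
    have : iota t + (n : ℚ) • sg 1 - (iota s + (n : ℚ) • sg a) =
      (iota t - iota s) - ((n : ℚ) • sg a - (n : ℚ) • sg 1) := by abel
    rw [this, e, sub_self]
  apply L.cancel (u := t)
  rw [add_comm, e2, add_comm _ t]
  exact h.add (L.refl _)

theorem P_le {a b : A} (h : a ≤ b) : P (sg b - sg a) :=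
  P_of (s := {a}) (t := {b}) (Eventually.of_forall fun N => by
    rw [S_single, S_single]; exact d_mono _ h) (by simp [iota_single])

theorem P_orth1 {a b : A} (h : a ≤ ∼b) : P (sg (a + b) - (sg a + sg b)) :=
  P_of (s := {a} + {b}) (t := {a + b}) (Eventually.of_forall fun N => by
    rw [S_add, S_single, S_single, S_single, d_add _ h]) (by simp only [map_add, iota_single])

theorem P_orth2 {a b : A} (h : a ≤ ∼b) : P ((sg a + sg b) - sg (a + b)) :=
  P_of (t := {a} + {b}) (s := {a + b}) (Eventually.of_forall fun N => by
    rw [S_add, S_single, S_single, S_single, d_add _ h]) (by simp only [map_add, iota_single])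

theorem scal_aux (r : QI) (a : A) : ∀ᶠ N in atTop,
    S N (r.1.num.toNat • {a}) = S N (r.1.den • {d r a}) := by
  filter_upwards [eventually_ge_atTop (r.1.den)] with N hN
  have hnum : ((r.1.num.toNat : ℕ) : ℚ) = r.1.den * r.1 := by
    rw [Rat.den_mul_eq_num]
    have : ((r.1.num.toNat : ℕ) : ℤ) = r.1.num := Int.toNat_of_nonneg (Rat.num_nonneg.2 r.2.1)
    exact_mod_cast this
  have hd := r.1.den_pos
  have hN0 : (0 : ℚ) < N := by exact_mod_cast (by omega : 0 < N)
  have hle : (r.1.den : ℚ) / N ≤ 1 := by rw [div_le_one hN0]; exact_mod_cast hN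
  simp only [S_nsmul, S_single]
  let q : QI := ⟨r.1.den / N, by positivity, hle⟩
  rw [nsmul_d N (d r a) _ q rfl, d_d q r (QI.mul q r) rfl, nsmul_d N a _ (QI.mul q r)]
  rw [hnum, QI.mul_val]; simp only [q]; ring

theorem P_scal (r : QI) (a : A) : P (sg (d r a) - r.1 • sg a) ∧ P (r.1 • sg a - sg (d r a)) := by
  have hnum : ((r.1.num.toNat : ℕ) : ℚ) = r.1.den * r.1 := by
    rw [Rat.den_mul_eq_num]
    have : ((r.1.num.toNat : ℕ) : ℤ) = r.1.num := Int.toNat_of_nonneg (Rat.num_nonneg.2 r.2.1)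
    exact_mod_cast this
  constructor
  · refine ⟨r.1.den, r.1.num.toNat • {a}, r.1.den • {d r a}, r.1.den_pos,
      (scal_aux r a).mono fun N h => h.le, ?_⟩
    simp only [map_nsmul, ← Nat.cast_smul_eq_nsmul ℚ, iota_single, hnum]
    module
  · refine ⟨r.1.den, r.1.den • {d r a}, r.1.num.toNat • {a}, r.1.den_pos,
      (scal_aux r a).mono fun N h => h.ge, ?_⟩
    simp only [map_nsmul, ← Nat.cast_smul_eq_nsmul ℚ, iota_single, hnum]
    module

end DMV


theorem P_nonneg {A : Type} [DMVAlgebra A] (a : A) : P (sg a) :=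
  P_of (s := 0) (t := {a}) (Filter.Eventually.of_forall fun N => by
    simpa [S] using zero_le' _) (by simp [iota_single])

/-- the evaluation in `[0,1] ∩ ℚ` extending a valuation -/
def evq (x : ℕ → QI) : QForm → QI
  | .var n => x n
  | .neg φ => QI.star (evq x φ)
  | .imp φ ψ => QI.oplus (QI.star (evq x φ)) (evq x ψ)
  | .nabla r φ => QI.star (QI.mul r (QI.star (evq x φ)))

theorem evq_isEval (x : ℕ → QI) : IsEvalQ (evq x) :=
  ⟨fun _ _ => rfl, fun _ => rfl, fun _ _ => rfl⟩

section Final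
variable {A : Type} [DMVAlgebra A]

/-- relations for the complement of an element -/
noncomputable def negRel (a : A) : List (A →₀ ℚ) :=
  [sg (a + ∼a) - (sg a + sg ∼a), (sg a + sg ∼a) - sg (a + ∼a)]

theorem negRel_P (a : A) : ∀ v ∈ negRel a, P v := by
  intro v hv
  simp only [negRel, List.mem_cons, List.not_mem_nil, or_false] at hv
  rcases hv with rfl | rfl
  · exact P_orth1 (by simp)
  · exact P_orth2 (by simp)

theorem negRel_f {a : A} {f : (A →₀ ℚ) →ₗ[ℚ] ℚ} (h : ∀ v ∈ negRel a, 0 ≤ f v)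
    (h1 : f (sg 1) = 1) : f (sg ∼a) = 1 - f (sg a) := by
  have e1 := h _ (List.mem_cons_self)
  have e2 := h _ (List.mem_cons_of_mem _ List.mem_cons_self)
  simp only [add_n_self, map_sub, map_add, h1] at e1 e2
  linarith

theorem rel (hch : ∀ a b : A, a ≤ b ∨ b ≤ a) {e : QForm → A} (he : IsEval e) (ψ : QForm) :
    ∃ F : List (A →₀ ℚ), (∀ v ∈ F, P v) ∧ ∀ f : (A →₀ ℚ) →ₗ[ℚ] ℚ, (∀ v ∈ F, 0 ≤ f v) →
      f (sg 1) = 1 → ∀ x : ℕ → QI, (∀ n, (x n).1 = max 0 (min (f (sg (e (.var n)))) 1)) →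
      (evq x ψ).1 = f (sg (e ψ)) := by
  obtain ⟨hi, hn, hd⟩ := he
  simp only [oplus_eq] at hi
  induction ψ with
  | var n =>
    refine ⟨[sg (e (.var n)), sg 1 - sg (e (.var n))], ?_, ?_⟩
    · intro v hv
      simp only [List.mem_cons, List.not_mem_nil, or_false] at hv
      rcases hv with rfl | rfl
      · exact P_nonneg _
      · exact P_le (le_one' _)
    · intro f hf h1 x hx
      have e1 := hf _ (List.mem_cons_self)
      have e2 := hf _ (List.mem_cons_of_mem _ List.mem_cons_self)
      rw [map_sub, h1] at e2
      rw [evq, hx, min_eq_left (by linarith), max_eq_right e1]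
  | neg φ ih =>
    obtain ⟨F, hF, hf⟩ := ih
    refine ⟨F ++ negRel (e φ), ?_, ?_⟩
    · intro v hv
      rcases List.mem_append.1 hv with hv | hv
      · exact hF v hv
      · exact negRel_P _ v hv
    · intro f hf' h1 x hx
      have e1 := hf f (fun v hv => hf' v (List.mem_append_left _ hv)) h1 x hx
      have e2 := negRel_f (fun v hv => hf' v (List.mem_append_right _ hv)) h1
      rw [evq, QI.star_val, e1, hn, e2]
  | imp φ ψ ih1 ih2 =>
    obtain ⟨F, hF, hf⟩ := ih1
    obtain ⟨G, hG, hg⟩ := ih2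
    rcases hch (e φ) (e ψ) with hle | hle
    · refine ⟨(sg (e ψ) - sg (e φ)) :: (F ++ G), ?_, ?_⟩
      · intro v hv
        rcases List.mem_cons.1 hv with rfl | hv
        · exact P_le hle
        rcases List.mem_append.1 hv with hv | hv
        · exact hF v hv
        · exact hG v hv
      · intro f hf' h1 x hx
        have e1 := hf f (fun v hv => hf' v (by simp [hv])) h1 x hx
        have e2 := hg f (fun v hv => hf' v (by simp [hv])) h1 x hx
        have e3 := hf' _ (List.mem_cons_self)
        rw [map_sub] at e3
        rw [evq, QI.oplus_val, QI.star_val, e1, e2, hi, (le_def _ _).1 hle, h1]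
        exact min_eq_right (by linarith)
    · refine ⟨(sg (e φ) - sg (e ψ)) :: (sg (∼(e φ) + e ψ) - (sg ∼(e φ) + sg (e ψ))) ::
        ((sg ∼(e φ) + sg (e ψ)) - sg (∼(e φ) + e ψ)) :: (F ++ G ++ negRel (e φ)), ?_, ?_⟩
      · intro v hv
        rcases List.mem_cons.1 hv with rfl | hv
        · exact P_le hle
        rcases List.mem_cons.1 hv with rfl | hv
        · exact P_orth1 (n_anti hle)
        rcases List.mem_cons.1 hv with rfl | hv
        · exact P_orth2 (n_anti hle)
        rcases List.mem_append.1 hv with hv | hv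
        · rcases List.mem_append.1 hv with hv | hv
          · exact hF v hv
          · exact hG v hv
        · exact negRel_P _ v hv
      · intro f hf' h1 x hx
        have e1 := hf f (fun v hv => hf' v (by simp [hv])) h1 x hx
        have e2 := hg f (fun v hv => hf' v (by simp [hv])) h1 x hx
        have e3 := hf' _ (List.mem_cons_self)
        have e4 := hf' _ (List.mem_cons_of_mem _ List.mem_cons_self)
        have e5 := hf' _ (List.mem_cons_of_mem _ (List.mem_cons_of_mem _ List.mem_cons_self))
        have e6 := negRel_f (a := e φ) (f := f) (fun v hv => hf' v (by simp [hv])) h1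
        simp only [map_sub, map_add] at e3 e4 e5
        rw [evq, QI.oplus_val, QI.star_val, e1, e2, hi, min_eq_left (by linarith)]
        linarith
  | nabla r φ ih =>
    obtain ⟨F, hF, hf⟩ := ih
    refine ⟨(sg (d r ∼(e φ)) - r.1 • sg ∼(e φ)) :: (r.1 • sg ∼(e φ) - sg (d r ∼(e φ))) ::
      (F ++ negRel (e φ) ++ negRel (d r ∼(e φ))), ?_, ?_⟩
    · intro v hv
      rcases List.mem_cons.1 hv with rfl | hv
      · exact (P_scal _ _).1
      rcases List.mem_cons.1 hv with rfl | hv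
      · exact (P_scal _ _).2
      rcases List.mem_append.1 hv with hv | hv
      · rcases List.mem_append.1 hv with hv | hv
        · exact hF v hv
        · exact negRel_P _ v hv
      · exact negRel_P _ v hv
    · intro f hf' h1 x hx
      have e1 := hf f (fun v hv => hf' v (by simp [hv])) h1 x hx
      have e3 := hf' _ (List.mem_cons_self)
      have e4 := hf' _ (List.mem_cons_of_mem _ List.mem_cons_self)
      have e5 := negRel_f (a := e φ) (f := f) (fun v hv => hf' v (by simp [hv])) h1
      have e6 := negRel_f (a := d r ∼(e φ)) (f := f) (fun v hv => hf' v (by simp [hv])) h1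
      rw [map_sub, map_smul, smul_eq_mul, e5] at e3 e4
      rw [evq, QI.star_val, QI.mul_val, QI.star_val, e1, hd, e6]
      linarith

theorem exists_evq (hch : ∀ a b : A, a ≤ b ∨ b ≤ a) {e : QForm → A} (he : IsEval e)
    {φ : QForm} (hφ : e φ ≠ 1) : ∃ x, evq x φ ≠ QI.one := by
  obtain ⟨F, hF, hf⟩ := rel hch he φ
  obtain ⟨f, hfF, hfb⟩ := farkas P P_zero P_add P_smul _ (sg (e φ) :: F) (sg (e φ) - sg 1) rfl
    (by
      intro v hv
      rcases List.mem_cons.1 hv with rfl | hv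
      · exact P_nonneg _
      · exact hF v hv)
    (fun h => hφ (not_P h))
  have h0 := hfF _ List.mem_cons_self
  rw [map_sub] at hfb
  have hc : 0 < f (sg 1) := by linarith
  let g : (A →₀ ℚ) →ₗ[ℚ] ℚ := (f (sg 1))⁻¹ • f
  have hg : ∀ v, g v = (f (sg 1))⁻¹ * f v := fun v => rfl
  let x : ℕ → QI := fun n => ⟨max 0 (min (g (sg (e (.var n)))) 1), le_max_left _ _,
    max_le zero_le_one (min_le_right _ _)⟩
  have := hf g (fun v hv => by
    rw [hg]; exact mul_nonneg (inv_nonneg.2 hc.le) (hfF v (List.mem_cons_of_mem _ hv)))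
    (by rw [hg]; exact inv_mul_cancel₀ hc.ne') x (fun n => rfl)
  refine ⟨x, fun h => ?_⟩
  rw [h, hg, QI.one_val] at this
  have h2 : f (sg 1) * 1 = f (sg (e φ)) := by
    rw [this, ← mul_assoc, mul_inv_cancel₀ hc.ne', one_mul]
  linarith

end Final

theorem prov_of_evq {φ : QForm} (h : ∀ e : QForm → QI, IsEvalQ e → e φ = QI.one) :
    QForm.Prov φ := by
  by_contra hφ
  obtain ⟨T, hT, hn, hp⟩ := exists_prime hφ
  obtain ⟨x, hx⟩ := exists_evq (A := hT.Q) (by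
    intro a b
    induction a using Quotient.inductionOn with | _ α =>
    induction b using Quotient.inductionOn with | _ β =>
    exact (hp α β).imp hT.ev_le.2 hT.ev_le.2) hT.ev_isEval (fun h1 => hn (hT.ev_one.1 h1))
  exact hx (h _ (evq_isEval x))

theorem evq_of_eval {φ : QForm}
    (h : ∀ (A : Type) [DMVAlgebra A] (e : QForm → A), IsEval e → e φ = MVAlgebra.one) :
    ∀ e : QForm → QI, IsEvalQ e → e φ = QI.one := by
  intro e he
  have := @h QI qiDMV e he
  rw [this]
  apply QI.ext'
  change (1 : ℚ) - 0 = 1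
  norm_num

end QLProof

/-- **Completeness of `𝒬Ł`.** For every formula `φ`, the following are
equivalent: (1) `φ` is provable; (2) `e(φ) = 1` for every evaluation into any
DMV-algebra; (3) `e(φ) = 1` for every evaluation into `[0,1] ∩ ℚ`; (4) the class
`[φ]` equals `1` (the class of theorems) in the Lindenbaum–Tarski algebra. -/
theorem completeness_QL (φ : QForm) :
    (QForm.Prov φ ↔
      (∀ (A : Type) [DMVAlgebra A] (e : QForm → A), IsEval e → e φ = MVAlgebra.one)) ∧
    (QForm.Prov φ ↔ (∀ e : QForm → QI, IsEvalQ e → e φ = QI.one)) ∧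
    (QForm.Prov φ ↔ (∀ ψ : QForm, QForm.Prov ψ → ProvEquiv φ ψ)) := by
  have h12 : QForm.Prov φ →
      (∀ (A : Type) [DMVAlgebra A] (e : QForm → A), IsEval e → e φ = MVAlgebra.one) :=
    fun h A _ e he => QLProof.sound he h
  refine ⟨⟨h12, fun h => QLProof.prov_of_evq (QLProof.evq_of_eval h)⟩,
    ⟨fun h => QLProof.evq_of_eval (h12 h), QLProof.prov_of_evq⟩, ⟨fun h ψ hψ => ?_, fun h => ?_⟩⟩
  · exact ⟨.MP _ _ hψ (.L1 _ _), .MP _ _ h (.L1 _ _)⟩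
  · have h0 := QLProof.th_prov.id (QForm.var 0)
    exact .MP _ _ h0 (h _ h0).2
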